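/- Let C be a rank-metric code in F_q^{n×m} with n ≤ m. Then maxrk(C) + maxrk(C^⊥) ≥ n. -/

import Mathlib

open Matrix

/-- The maximum rank of a rank-metric code (an `𝔽`-linear subspace of `n × m` matrices). -/
noncomputable def maxrk {𝔽 : Type*} [Field 𝔽] {n m : ℕ}
    (C : Submodule 𝔽 (Matrix (Fin n) (Fin m) 𝔽)) : ℕ :=
  sSup (Matrix.rank '' (C : Set (Matrix (Fin n) (Fin m) 𝔽)))

/-- The dual code with respect to the trace bilinear form `⟨M, N⟩ = Tr(M Nᵗ)`. -/
def dualCode {𝔽 : Type*} [Field 𝔽] {n m : ℕ}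
    (C : Submodule 𝔽 (Matrix (Fin n) (Fin m) 𝔽)) :
    Submodule 𝔽 (Matrix (Fin n) (Fin m) 𝔽) where
  carrier := {M | ∀ N ∈ C, Matrix.trace (M * Nᵀ) = 0}
  add_mem' := by
    intro a b ha hb N hN
    show Matrix.trace ((a + b) * Nᵀ) = 0
    rw [Matrix.add_mul, Matrix.trace_add, ha N hN, hb N hN, add_zero]
  zero_mem' := by
    intro N hN
    simp
  smul_mem' := by
    intro c a ha N hN
    show Matrix.trace ((c • a) * Nᵀ) = 0
    rw [Matrix.smul_mul, Matrix.trace_smul, ha N hN, smul_zero]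

/-- `C` is an optimal anticode if `dim C = m * maxrk C`. -/
def isOptAnticode {𝔽 : Type*} [Field 𝔽] {n m : ℕ}
    (C : Submodule 𝔽 (Matrix (Fin n) (Fin m) 𝔽)) : Prop :=
  Module.finrank 𝔽 C = m * maxrk C

/-- `C` is a quasi optimal anticode if `m ∤ dim C` and `maxrk C = ⌈dim C / m⌉`. -/
def isQOAC {𝔽 : Type*} [Field 𝔽] {n m : ℕ}
    (C : Submodule 𝔽 (Matrix (Fin n) (Fin m) 𝔽)) : Prop :=
  ¬ (m ∣ Module.finrank 𝔽 C) ∧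
    (maxrk C : ℤ) = ⌈(Module.finrank 𝔽 C : ℚ) / (m : ℚ)⌉

/-- `C` is a dually quasi optimal anticode if both `C` and `C^⊥` are qOACs. -/
def isDuallyQOAC {𝔽 : Type*} [Field 𝔽] {n m : ℕ}
    (C : Submodule 𝔽 (Matrix (Fin n) (Fin m) 𝔽)) : Prop :=
  isQOAC C ∧ isQOAC (dualCode C)

/-- The code of matrices vanishing at all positions `(i, j)` with `¬ P i j`. -/
def zeroOutside {𝔽 : Type*} [Field 𝔽] {n m : ℕ} (P : Fin n → Fin m → Prop) :
    Submodule 𝔽 (Matrix (Fin n) (Fin m) 𝔽) where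
  carrier := {M | ∀ i j, ¬ P i j → M i j = 0}
  add_mem' := by
    intro a b ha hb i j h
    simp [Matrix.add_apply, ha i j h, hb i j h]
  zero_mem' := by
    intro i j h
    simp
  smul_mem' := by
    intro c a ha i j h
    simp [Matrix.smul_apply, ha i j h]

/-- `Mat(V)`: the matrices all of whose columns lie in `V ⊆ 𝔽^n`. -/
def matCol {𝔽 : Type*} [Field 𝔽] {n m : ℕ} (V : Submodule 𝔽 (Fin n → 𝔽)) :
    Submodule 𝔽 (Matrix (Fin n) (Fin m) 𝔽) where
  carrier := {M | ∀ j, (fun i => M i j) ∈ V}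
  add_mem' := by
    intro a b ha hb j
    exact V.add_mem (ha j) (hb j)
  zero_mem' := by
    intro j
    exact V.zero_mem
  smul_mem' := by
    intro c a ha j
    exact V.smul_mem c (ha j)

/-- `Mat(U)ᵗ`: the matrices all of whose rows lie in `U ⊆ 𝔽^m`. -/
def matRow {𝔽 : Type*} [Field 𝔽] {n m : ℕ} (U : Submodule 𝔽 (Fin m → 𝔽)) :
    Submodule 𝔽 (Matrix (Fin n) (Fin m) 𝔽) where
  carrier := {M | ∀ i, M i ∈ U}
  add_mem' := by
    intro a b ha hb i
    exact U.add_mem (ha i) (hb i)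
  zero_mem' := by
    intro i
    exact U.zero_mem
  smul_mem' := by
    intro c a ha i
    exact U.smul_mem c (ha i)

/-- `⟨e_1, …, e_s⟩ ⊆ 𝔽^ℓ`: the span of the first `s` canonical basis vectors. -/
def spanFirst (𝔽 : Type*) [Field 𝔽] (ℓ s : ℕ) : Submodule 𝔽 (Fin ℓ → 𝔽) :=
  Submodule.span 𝔽 ((fun i : Fin ℓ => Pi.single i (1 : 𝔽)) '' {i : Fin ℓ | (i : ℕ) < s})

/-- Orthogonal complement with respect to the standard dot product on `𝔽^ℓ`. -/
def perp {𝔽 : Type*} [Field 𝔽] {ℓ : ℕ} (W : Submodule 𝔽 (Fin ℓ → 𝔽)) :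
    Submodule 𝔽 (Fin ℓ → 𝔽) where
  carrier := {v | ∀ w ∈ W, ∑ i, v i * w i = 0}
  add_mem' := by
    intro a b ha hb w hw
    simp [add_mul, Finset.sum_add_distrib, ha w hw, hb w hw]
  zero_mem' := by
    intro w hw
    simp
  smul_mem' := by
    intro c a ha w hw
    simp [mul_assoc, ← Finset.mul_sum, ha w hw]

/-- Equivalence of rank-metric codes: `C = {N A M : A ∈ D}` for invertible `N, M`, or
(when `n = m`) `C = {N Aᵗ M : A ∈ D}` for invertible `N, M`. -/
def equivCode {𝔽 : Type*} [Field 𝔽] {n m : ℕ}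
    (C D : Submodule 𝔽 (Matrix (Fin n) (Fin m) 𝔽)) : Prop :=
  (∃ (N : Matrix (Fin n) (Fin n) 𝔽) (M : Matrix (Fin m) (Fin m) 𝔽),
      IsUnit N ∧ IsUnit M ∧
      (C : Set (Matrix (Fin n) (Fin m) 𝔽)) = (fun A : Matrix (Fin n) (Fin m) 𝔽 => N * A * M) '' (D : Set (Matrix (Fin n) (Fin m) 𝔽))) ∨
  (∃ (h : n = m) (N : Matrix (Fin n) (Fin n) 𝔽) (M : Matrix (Fin m) (Fin m) 𝔽),
      IsUnit N ∧ IsUnit M ∧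
      (C : Set (Matrix (Fin n) (Fin m) 𝔽)) =
        (fun A : Matrix (Fin n) (Fin m) 𝔽 =>
          N * (Matrix.reindex (finCongr h.symm) (finCongr h) Aᵀ) * M) ''
          (D : Set (Matrix (Fin n) (Fin m) 𝔽)))

/-- The Gaussian `q`-binomial coefficient, as a rational number. -/
def gaussBinom (q a r : ℕ) : ℚ :=
  (∏ i ∈ Finset.range r, ((q : ℚ) ^ a - (q : ℚ) ^ i)) /
    (∏ i ∈ Finset.range r, ((q : ℚ) ^ r - (q : ℚ) ^ i))

/-- `φ_q(a, b, r)`: the number of rank-`r` matrices in `𝔽_q^{a×b}`. -/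
def phiq (q a b r : ℕ) : ℚ :=
  gaussBinom q a r * ∏ i ∈ Finset.range r, ((q : ℚ) ^ b - (q : ℚ) ^ i)

/-- The `K`-linear endomorphism `x ↦ ∑ i, a i * x ^ q ^ i` of a field extension `L` of the finite
field `K` with `q` elements, as a linear function of the coefficients. -/
noncomputable def linearizedPoly (K L : Type*) [Field K] [Fintype K] [Field L] [Algebra K L]
    (k : ℕ) : (Fin k → L) →ₗ[K] L →ₗ[K] L :=
  ∑ i : Fin k, (LinearMap.lcomp K L (FiniteField.frobeniusAlgHom K L ^ (i : ℕ)).toLinearMap) ∘ₗ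
    (LinearMap.mul K L) ∘ₗ (LinearMap.proj i)

theorem linearizedPoly_apply {K L : Type*} [Field K] [Fintype K] [Field L] [Algebra K L]
    {k : ℕ} (a : Fin k → L) (x : L) :
    linearizedPoly K L k a x = ∑ i : Fin k, a i * x ^ Fintype.card K ^ (i : ℕ) := by
  simp [linearizedPoly, LinearMap.sum_apply, AlgHom.coe_pow, FiniteField.coe_frobeniusAlgHom,
    pow_iterate]

/-- The kernel of a nonzero linearized polynomial with `k` coefficients, restricted along an
injective map, has dimension less than `k`. -/
theorem finrank_ker_linearizedPoly_comp_lt {K L V : Type*} [Field K] [Fintype K] [Field L]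
    [Algebra K L] [AddCommGroup V] [Module K V] [FiniteDimensional K V] {k : ℕ} {a : Fin k → L}
    (ha : a ≠ 0) {ι : V →ₗ[K] L} (hι : Function.Injective ι) :
    Module.finrank K (LinearMap.ker (linearizedPoly K L k a ∘ₗ ι)) < k := by
  classical
  set q := Fintype.card K
  have hq : 1 < q := Fintype.one_lt_card
  set W := LinearMap.ker (linearizedPoly K L k a ∘ₗ ι)
  set P : Polynomial L := ∑ i : Fin k, Polynomial.monomial (q ^ (i : ℕ)) (a i) with hP
  have hcoeff (j : Fin k) : P.coeff (q ^ (j : ℕ)) = a j := by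
    simp [hP, Polynomial.finsetSum_coeff, Polynomial.coeff_monomial,
      (Nat.pow_right_injective hq).eq_iff, Fin.val_inj]
  obtain ⟨j, hj⟩ := Function.ne_iff.mp ha
  have hP0 : P ≠ 0 := fun h => hj (by rw [← hcoeff, h]; rfl)
  have hdeg : P.natDegree ≤ q ^ (k - 1) :=
    Polynomial.natDegree_sum_le_of_forall_le _ _ fun i _ =>
      (Polynomial.natDegree_monomial_le _).trans (Nat.pow_le_pow_right hq.le (by omega))
  have hroot (w : W) : ι w ∈ P.roots.toFinset := by
    have hw : linearizedPoly K L k a (ι w) = 0 := w.2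
    rw [Multiset.mem_toFinset, Polynomial.mem_roots hP0, Polynomial.IsRoot, ← hw,
      linearizedPoly_apply, hP, Polynomial.eval_finsetSum]
    simp [q]
  have hcard : q ^ Module.finrank K W ≤ q ^ (k - 1) := by
    calc q ^ Module.finrank K W = Nat.card W := by
          rw [Module.natCard_eq_pow_finrank (K := K), Nat.card_eq_fintype_card]
      _ ≤ Nat.card P.roots.toFinset :=
          Nat.card_le_card_of_injective (fun w => ⟨ι w, hroot w⟩) fun v w h =>
            Subtype.ext (hι (congrArg Subtype.val h))
      _ = P.roots.toFinset.card := Nat.card_eq_fintype_card.trans (Fintype.card_coe _)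
      _ ≤ P.natDegree := (Multiset.toFinset_card_le _).trans P.card_roots'
      _ ≤ q ^ (k - 1) := hdeg
  have := (Nat.pow_le_pow_iff_right hq).mp hcard
  have := j.pos
  omega

theorem rank_le_maxrk {K : Type*} [Field K] {n m : ℕ}
    {C : Submodule K (Matrix (Fin n) (Fin m) K)} {A : Matrix (Fin n) (Fin m) K} (hA : A ∈ C) :
    A.rank ≤ maxrk C :=
  le_csSup ⟨n, by rintro _ ⟨B, -, rfl⟩; exact B.rank_le_height⟩ ⟨A, hA, rfl⟩

/-- The anticode bound. -/
theorem finrank_le_mul_maxrk {K : Type*} [Field K] [Fintype K] {n m : ℕ} (hm : 1 ≤ m)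
    (hnm : n ≤ m) (C : Submodule K (Matrix (Fin n) (Fin m) K)) :
    Module.finrank K C ≤ m * maxrk C := by
  by_contra! hlt
  have : NeZero m := ⟨by omega⟩
  have : Fact (ringChar K).Prime := ⟨CharP.char_is_prime K _⟩
  let L := FiniteField.Extension K (ringChar K) m
  have hL : Module.finrank K L = m := FiniteField.finrank_extension K (ringChar K) m
  let e : (Fin m → K) ≃ₗ[K] L := LinearEquiv.ofFinrankEq _ _ (by simp [hL])
  let ι : (Fin n → K) →ₗ[K] L :=
    e.toLinearMap ∘ₗ Function.ExtendByZero.linearMap K (Fin.castLE hnm)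
  have hι : Function.Injective ι :=
    e.injective.comp (Function.extend_injective (Fin.castLE_injective hnm) 0)
  let k := n - maxrk C
  let T : C →ₗ[K] (Fin n → K) →ₗ[K] L :=
    LinearMap.compRight K e.toLinearMap ∘ₗ Matrix.toLin'.toLinearMap ∘ₗ
      (Matrix.transposeLinearEquiv (Fin n) (Fin m) K K).toLinearMap ∘ₗ C.subtype
  let S : (Fin k → L) →ₗ[K] (Fin n → K) →ₗ[K] L :=
    LinearMap.lcomp K L ι ∘ₗ linearizedPoly K L k
  have hT (A : C) : T A = e.toLinearMap ∘ₗ Matrix.toLin' (A : Matrix (Fin n) (Fin m) K)ᵀ := rfl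
  have hS (a : Fin k → L) : S a = linearizedPoly K L k a ∘ₗ ι := rfl
  have hker : LinearMap.ker (T.coprod S) ≠ ⊥ := by
    apply LinearMap.ker_ne_bot_of_finrank_lt
    have hdim : Module.finrank K (Fin k → L) = k * m := by
      simp [Module.finrank_pi_fintype, hL]
    rw [Module.finrank_prod, hdim, Module.finrank_linearMap, hL, Module.finrank_fin_fun]
    have : n ≤ maxrk C + k := by omega
    nlinarith
  obtain ⟨⟨A, a⟩, hAa, hne⟩ := (Submodule.ne_bot_iff _).mp hker
  have heq : T A = -S a := by
    rw [LinearMap.mem_ker, LinearMap.coprod_apply] at hAa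
    exact eq_neg_of_add_eq_zero_left hAa
  have hkerA : LinearMap.ker (T A) =
      LinearMap.ker (Matrix.toLin' (A : Matrix (Fin n) (Fin m) K)ᵀ) := by
    rw [hT, LinearEquiv.ker_comp]
  have ha : a ≠ 0 := by
    rintro rfl
    refine hne (Prod.ext (Subtype.ext ?_) rfl)
    rw [map_zero, neg_zero, hT] at heq
    have h0 : Matrix.toLin' (A : Matrix (Fin n) (Fin m) K)ᵀ = 0 := by
      ext1 i
      ext1
      apply e.injective
      simpa using LinearMap.congr_fun heq (Pi.single i 1)
    simpa using h0
  have hlt := finrank_ker_linearizedPoly_comp_lt ha hι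
  have hrn := LinearMap.finrank_range_add_finrank_ker
    (Matrix.toLin' (A : Matrix (Fin n) (Fin m) K)ᵀ)
  have hrank : Module.finrank K
      (LinearMap.range (Matrix.toLin' (A : Matrix (Fin n) (Fin m) K)ᵀ)) ≤ maxrk C := by
    have := rank_le_maxrk A.2
    rwa [← Matrix.rank_transpose] at this
  rw [← hkerA, heq, hS, Module.finrank_fin_fun] at hrn
  have hneg : LinearMap.ker (-(linearizedPoly K L k a ∘ₗ ι)) =
      LinearMap.ker (linearizedPoly K L k a ∘ₗ ι) := by
    ext; simp
  rw [hneg] at hrn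
  omega

theorem mul_le_finrank_add_finrank_dualCode {K : Type*} [Field K] {n m : ℕ}
    (C : Submodule K (Matrix (Fin n) (Fin m) K)) :
    n * m ≤ Module.finrank K C + Module.finrank K (dualCode C) := by
  let B : Matrix (Fin n) (Fin m) K →ₗ[K] Module.Dual K C :=
    LinearMap.mk₂ K (fun M (N : C) => Matrix.trace (M * (N : Matrix (Fin n) (Fin m) K)ᵀ))
      (by simp [Matrix.add_mul]) (by simp) (by simp [Matrix.mul_add]) (by simp)
  have hB : LinearMap.ker B = dualCode C := by
    ext M
    rw [LinearMap.mem_ker, LinearMap.ext_iff, Subtype.forall]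
    rfl
  have hrn := LinearMap.finrank_range_add_finrank_ker B
  have hle := Submodule.finrank_le (LinearMap.range B)
  rw [Subspace.dual_finrank_eq] at hle
  rw [hB, Module.finrank_matrix, Module.finrank_self, Fintype.card_fin, Fintype.card_fin] at hrn
  omega

/-- For any rank-metric code `C ⊆ 𝔽_q^{n×m}` with `n ≤ m`,
`maxrk(C) + maxrk(C^⊥) ≥ n`. -/
theorem stmt0 {𝔽 : Type*} [Field 𝔽] [Fintype 𝔽] {n m : ℕ} (hn : 1 ≤ n) (hnm : n ≤ m)
    (C : Submodule 𝔽 (Matrix (Fin n) (Fin m) 𝔽)) :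
    n ≤ maxrk C + maxrk (dualCode C) := by
  have hm : 1 ≤ m := hn.trans hnm
  have hdim := mul_le_finrank_add_finrank_dualCode C
  have hC := finrank_le_mul_maxrk hm hnm C
  have hD := finrank_le_mul_maxrk hm hnm (dualCode C)
  exact le_of_mul_le_mul_left (by linarith) (Nat.lt_of_lt_of_le Nat.zero_lt_one hm)
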